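/- arXiv:2503.02327 — 5 statements merged into one kernel-verified Lean document; each statement's English description precedes it below -/
import Mathlib

section
/- Let I be a nonempty finite set of players and A a nonempty finite action set, with utility functions U : I → (I → A) → ℝ. Fix K ≥ 1 and a sequence of joint action profiles f : Fin K → (I → A), and let π̄ be the empirical distribution of the sequence, defined by π̄(g) = (card {k | f k = g}) / K for each profile g : I → A. If every player's average external regret is at most ε, i.e. for every player i and every deviation a' ∈ A one has (1/K) · Σ_{k} ( U i (Function.update (f k) i a') − U i (f k) ) ≤ ε, then π̄ is an ε-coarse correlated equilibrium: for every player i and every a' ∈ A, Σ_{g} π̄(g) · U i (Function.update g i a') − Σ_{g} π̄(g) · U i g ≤ ε. -/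
/-- The expectation of `F` under the empirical distribution of a finite sequence is
the average of `F` along the sequence. -/
theorem sum_card_fiber_div_mul {α : Type*} [Fintype α] [DecidableEq α] {K : ℕ}
    (f : Fin K → α) (F : α → ℝ) :
    ∑ g, ((Finset.univ.filter (fun k : Fin K => f k = g)).card : ℝ) / K * F g =
      (1 / K : ℝ) * ∑ k, F (f k) := by
  rw [← Finset.sum_fiberwise Finset.univ f (fun k => F (f k)), Finset.mul_sum]
  refine Finset.sum_congr rfl fun g _ => ?_
  have hconst : ∑ k with f k = g, F (f k) =
      ((Finset.univ.filter (fun k : Fin K => f k = g)).card : ℝ) * F g := by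
    rw [← nsmul_eq_mul]
    exact Finset.sum_eq_card_nsmul fun k hk => by rw [(Finset.mem_filter.mp hk).2]
  rw [hconst]
  ring

/-- No-regret play implies the empirical distribution of joint action profiles
is an ε-coarse correlated equilibrium. -/
theorem empirical_distribution_of_no_regret_play_is_eps_CCE
    {I A : Type*} [Fintype I] [Nonempty I] [DecidableEq I]
    [Fintype A] [Nonempty A] [DecidableEq A]
    (U : I → (I → A) → ℝ) (K : ℕ) (hK : 1 ≤ K)
    (f : Fin K → (I → A)) (ε : ℝ)
    (πbar : (I → A) → ℝ)
    (hπ : ∀ g : I → A,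
      πbar g = ((Finset.univ.filter (fun k : Fin K => f k = g)).card : ℝ) / K)
    (hregret : ∀ i : I, ∀ a' : A,
      (1 / K : ℝ) *
        ∑ k : Fin K, (U i (Function.update (f k) i a') - U i (f k)) ≤ ε) :
    ∀ i : I, ∀ a' : A,
      (∑ g : I → A, πbar g * U i (Function.update g i a')) -
        (∑ g : I → A, πbar g * U i g) ≤ ε := by
  intro i a'
  simp only [hπ]
  rw [sum_card_fiber_div_mul f fun g => U i (Function.update g i a'),
    sum_card_fiber_div_mul f (U i), ← mul_sub, ← Finset.sum_sub_distrib]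
  exact hregret i a'
end

section
/- Let I be a nonempty finite set of players and A a nonempty finite action set, with utility functions U : I → (I → A) → ℝ. Fix K ≥ 1 and let μ be a probability mass function (PMF) on sequences of joint profiles f : Fin K → (I → A). Define the averaged empirical distribution π̄_μ on joint profiles by π̄_μ(g) = E_{f∼μ}[ (card {k | f k = g}) / K ]. Suppose every player has expected average external regret at most ε under μ: for every player i and every a' ∈ A, E_{f∼μ}[ (1/K) · Σ_k ( U i (Function.update (f k) i a') − U i (f k) ) ] ≤ ε. Then π̄_μ is an ε-coarse correlated equilibrium: for every player i and a' ∈ A, Σ_g π̄_μ(g) · U i (Function.update g i a') − Σ_g π̄_μ(g) · U i g ≤ ε. -/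
/-- Summing `h` against the occurrence counts of `F` is summing `h ∘ F`. -/
theorem sum_card_fiber_mul {κ G : Type*} [Fintype κ] [Fintype G] [DecidableEq G]
    (F : κ → G) (h : G → ℝ) :
    ∑ g : G, ((Finset.univ.filter (fun k : κ => F k = g)).card : ℝ) * h g =
      ∑ k : κ, h (F k) := by
  rw [← Finset.sum_fiberwise Finset.univ F (fun k => h (F k))]
  refine Finset.sum_congr rfl fun g _ => ?_
  rw [Finset.sum_congr rfl (g := fun _ => h g)
    (fun k hk => by rw [(Finset.mem_filter.mp hk).2]), Finset.sum_const, nsmul_eq_mul]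

/-- The expectation of `h` under an averaged empirical distribution is the expected
time average of `h`. -/
theorem sum_averaged_empirical_mul {κ G : Type*} [Fintype κ] [DecidableEq κ]
    [Fintype G] [DecidableEq G] (w : (κ → G) → ℝ) (c : ℝ) (h : G → ℝ) :
    ∑ g : G, (∑ F : κ → G, w F *
        (((Finset.univ.filter (fun k : κ => F k = g)).card : ℝ) / c)) * h g =
      ∑ F : κ → G, w F * ((1 / c) * ∑ k : κ, h (F k)) := by
  simp_rw [Finset.sum_mul]
  rw [Finset.sum_comm]
  refine Finset.sum_congr rfl fun F _ => ?_
  rw [← sum_card_fiber_mul F h, Finset.mul_sum, Finset.mul_sum]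
  refine Finset.sum_congr rfl fun g _ => ?_
  ring

/-- If the (random) sequence of plays has expected average external regret at most ε
for every player, then the averaged empirical distribution of joint profiles is an
ε-coarse correlated equilibrium. -/
theorem averaged_empirical_distribution_of_no_regret_play_is_eps_CCE
    {I A : Type*} [Fintype I] [Nonempty I] [DecidableEq I]
    [Fintype A] [Nonempty A] [DecidableEq A]
    (U : I → (I → A) → ℝ) (K : ℕ) (hK : 1 ≤ K)
    (μ : PMF (Fin K → (I → A))) (ε : ℝ)
    (πbar : (I → A) → ℝ)
    (hπ : ∀ g : I → A,
      πbar g = ∑ F : Fin K → (I → A), (μ F).toReal *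
        (((Finset.univ.filter (fun k : Fin K => F k = g)).card : ℝ) / K))
    (hregret : ∀ i : I, ∀ a' : A,
      ∑ F : Fin K → (I → A), (μ F).toReal *
        ((1 / K : ℝ) *
          ∑ k : Fin K, (U i (Function.update (F k) i a') - U i (F k))) ≤ ε) :
    ∀ i : I, ∀ a' : A,
      (∑ g : I → A, πbar g * U i (Function.update g i a')) -
        (∑ g : I → A, πbar g * U i g) ≤ ε := by
  intro i a'
  rw [← Finset.sum_sub_distrib]
  simp_rw [← mul_sub, hπ]
  rw [sum_averaged_empirical_mul (fun F => (μ F).toReal) (K : ℝ)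
    (fun g => U i (Function.update g i a') - U i g)]
  exact hregret i a'
end

section
/- Let I be a nonempty finite set of players and A a nonempty finite action set with cardinality A₀ = card A ≥ 2, with utility functions U : I → (I → A) → ℝ. Let C > 0. Suppose that for every horizon K ≥ 1 there is a PMF μ_K on sequences f : Fin K → (I → A) under which every player's expected average external regret is at most C·√(A₀ · log A₀ / K): for every i and a' ∈ A, E_{f∼μ_K}[(1/K)·Σ_k (U i (Function.update (f k) i a') − U i (f k))] ≤ C·√(A₀ · log A₀ / K). Then for every δ > 0 and every K ≥ C² · A₀ · log A₀ / δ², the averaged empirical distribution π̄_{μ_K}(g) = E_{f∼μ_K}[(card {k | f k = g})/K] is a δ-coarse correlated equilibrium: for every player i and a' ∈ A, Σ_g π̄_{μ_K}(g) · U i (Function.update g i a') − Σ_g π̄_{μ_K}(g) · U i g ≤ δ. -/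
/-- Averaging an observable against the weighted empirical distribution of sequences is the same
as averaging its empirical mean over the sequences. -/
theorem sum_weighted_empirical_mul {G : Type*} [Fintype G] [DecidableEq G] {K : ℕ}
    (w : (Fin K → G) → ℝ) (V : G → ℝ) :
    ∑ g : G, (∑ F : Fin K → G, w F *
        (((Finset.univ.filter (fun k : Fin K => F k = g)).card : ℝ) / K)) * V g =
      ∑ F : Fin K → G, w F * ((1 / K : ℝ) * ∑ k : Fin K, V (F k)) := by
  have key (F : Fin K → G) : ∑ k : Fin K, V (F k) =
      ∑ g : G, ((Finset.univ.filter (fun k : Fin K => F k = g)).card : ℝ) * V g := by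
    rw [← Finset.sum_fiberwise Finset.univ F]
    refine Finset.sum_congr rfl fun g _ => ?_
    rw [← nsmul_eq_mul]
    refine Finset.sum_eq_card_nsmul fun k hk => ?_
    rw [(Finset.mem_filter.mp hk).2]
  simp_rw [key, Finset.sum_mul, Finset.mul_sum]
  rw [Finset.sum_comm]
  refine Finset.sum_congr rfl fun F _ => Finset.sum_congr rfl fun g _ => ?_
  ring

/-- A regret rate of order √(A₀ log A₀ / K) implies that for every δ > 0 and
every horizon K ≥ C²·A₀·log A₀/δ², the averaged empirical distribution of play
is a δ-coarse correlated equilibrium. -/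
theorem averaged_empirical_distribution_converges_to_CCE
    {I A : Type*} [Fintype I] [Nonempty I] [DecidableEq I]
    [Fintype A] [Nonempty A] [DecidableEq A]
    (A₀ : ℕ) (hA₀ : A₀ = Fintype.card A) (hA₀2 : 2 ≤ A₀)
    (U : I → (I → A) → ℝ) (C : ℝ) (hC : 0 < C)
    (μ : (K : ℕ) → PMF (Fin K → (I → A)))
    (hregret : ∀ K : ℕ, 1 ≤ K → ∀ i : I, ∀ a' : A,
      ∑ F : Fin K → (I → A), ((μ K) F).toReal *
        ((1 / K : ℝ) *
          ∑ k : Fin K, (U i (Function.update (F k) i a') - U i (F k)))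
        ≤ C * Real.sqrt ((A₀ * Real.log A₀) / K)) :
    ∀ δ : ℝ, 0 < δ → ∀ K : ℕ, (C ^ 2 * A₀ * Real.log A₀) / δ ^ 2 ≤ (K : ℝ) →
      ∀ i : I, ∀ a' : A,
        (∑ g : I → A,
            (∑ F : Fin K → (I → A), ((μ K) F).toReal *
              (((Finset.univ.filter (fun k : Fin K => F k = g)).card : ℝ) / K)) *
            U i (Function.update g i a')) -
          (∑ g : I → A,
            (∑ F : Fin K → (I → A), ((μ K) F).toReal *
              (((Finset.univ.filter (fun k : Fin K => F k = g)).card : ℝ) / K)) *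
            U i g) ≤ δ := by
  intro δ hδ K hK i a'
  have hA₀' : (1 : ℝ) < A₀ := by exact_mod_cast hA₀2
  have hlog : 0 < Real.log A₀ := Real.log_pos hA₀'
  have hKpos : (0 : ℝ) < K := lt_of_lt_of_le (by positivity) hK
  have hrate : C * Real.sqrt ((A₀ * Real.log A₀) / K) ≤ δ := by
    rw [← le_div_iff₀' hC]
    refine Real.sqrt_le_iff.mpr ⟨by positivity, ?_⟩
    rw [div_le_iff₀ (by positivity)] at hK
    rw [div_pow, div_le_div_iff₀ hKpos (by positivity)]
    linarith
  refine le_trans (le_of_eq ?_) ((hregret K (by exact_mod_cast hKpos) i a').trans hrate)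
  rw [sum_weighted_empirical_mul (fun F => ((μ K) F).toReal)
      (fun g => U i (Function.update g i a')),
    sum_weighted_empirical_mul (fun F => ((μ K) F).toReal) (U i), ← Finset.sum_sub_distrib]
  refine Finset.sum_congr rfl fun F _ => ?_
  rw [Finset.sum_sub_distrib, mul_sub, mul_sub]
end

section
/- Exponential-weights (Hedge) regret bound. Let A be a nonempty finite set with cardinality A₀ ≥ 1, let T ≥ 1, let ℓ : Fin T → A → ℝ be a loss sequence with 0 ≤ ℓ t a ≤ 1 for all t, a, and let η > 0. For each round t define the mixed strategy p_t on A by p_t(a) = exp(−η · Σ_{s < t} ℓ s a) / Σ_{b ∈ A} exp(−η · Σ_{s < t} ℓ s b). Then Σ_{t} Σ_{a} p_t(a) · ℓ t a − min_{a ∈ A} Σ_{t} ℓ t a ≤ (log A₀)/η + η·T/8. -/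
open Finset

/-- Hoeffding's lemma for a finitely supported distribution `w` and a function with values in
`[0, 1]`. -/
theorem sum_mul_exp_le_exp_of_mem_Icc {A : Type*} [Fintype A] {w x : A → ℝ}
    (hw : ∀ a, 0 ≤ w a) (hw1 : ∑ a, w a = 1) (hx : ∀ a, x a ∈ Set.Icc (0 : ℝ) 1) (r : ℝ) :
    ∑ a, w a * Real.exp (r * x a) ≤ Real.exp (r * ∑ a, w a * x a + r ^ 2 / 8) := by
  let _ : MeasurableSpace A := ⊤
  let P : PMF A := PMF.ofFintype (fun a => ENNReal.ofReal (w a)) (by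
    rw [← ENNReal.ofReal_sum_of_nonneg fun a _ => hw a, hw1, ENNReal.ofReal_one])
  have hint (f : A → ℝ) : ∫ a, f a ∂P.toMeasure = ∑ a, w a * f a := by
    simp [PMF.integral_eq_sum, P, hw]
  have hmgf := (ProbabilityTheory.hasSubgaussianMGF_of_mem_Icc (μ := P.toMeasure)
    (measurable_from_top (f := x)).aemeasurable (.of_forall hx)).mgf_le r
  rw [ProbabilityTheory.mgf, hint, hint] at hmgf
  set m := ∑ a, w a * x a
  calc ∑ a, w a * Real.exp (r * x a)
      = Real.exp (r * m) * ∑ a, w a * Real.exp (r * (x a - m)) := by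
        rw [mul_sum]
        refine sum_congr rfl fun a _ => ?_
        rw [mul_left_comm, ← Real.exp_add]
        ring_nf
    _ ≤ Real.exp (r * m) * Real.exp (r ^ 2 / 8) := by
        gcongr
        refine hmgf.trans_eq ?_
        congr 1
        norm_num
        ring
    _ = _ := (Real.exp_add _ _).symm

/-- One step of exponential weights: multiplying the weights `v` by `exp (-η * x)` shrinks their
total by a factor controlled by the mean of `x` under the normalized weights. -/
theorem sum_mul_exp_neg_le {A : Type*} [Fintype A] [Nonempty A] {v x : A → ℝ}
    (hv : ∀ a, 0 < v a) (hx : ∀ a, x a ∈ Set.Icc (0 : ℝ) 1) (η : ℝ) :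
    ∑ a, v a * Real.exp (-η * x a) ≤
      (∑ a, v a) * Real.exp (-η * ∑ a, v a / (∑ b, v b) * x a + η ^ 2 / 8) := by
  have hV : 0 < ∑ b, v b := sum_pos (fun a _ => hv a) univ_nonempty
  have h := sum_mul_exp_le_exp_of_mem_Icc (w := fun a => v a / ∑ b, v b)
    (fun a => (div_pos (hv a) hV).le) (by rw [← sum_div, div_self hV.ne']) hx (-η)
  rw [neg_sq] at h
  refine le_trans (le_of_eq ?_) (mul_le_mul_of_nonneg_left h hV.le)
  rw [mul_sum]
  refine sum_congr rfl fun a _ => ?_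
  field_simp

/-- The total exponential weight after `k` rounds is bounded in terms of the losses incurred by the
exponential-weights strategy `p`. -/
theorem sum_exp_cumulative_loss_le {A : Type*} [Fintype A] [Nonempty A] {T : ℕ}
    {ℓ : Fin T → A → ℝ} (hℓ : ∀ t a, ℓ t a ∈ Set.Icc (0 : ℝ) 1) {η : ℝ} {p : Fin T → A → ℝ}
    (hp : ∀ (t : Fin T) (a : A),
      p t a = Real.exp (-η * ∑ s ∈ univ.filter (fun s : Fin T => s < t), ℓ s a) /
        ∑ b : A, Real.exp (-η * ∑ s ∈ univ.filter (fun s : Fin T => s < t), ℓ s b))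
    {k : ℕ} (hk : k ≤ T) :
    ∑ a, Real.exp (-η * ∑ s ∈ univ.filter (fun s : Fin T => s.val < k), ℓ s a) ≤
      Fintype.card A * Real.exp (∑ t ∈ univ.filter (fun t : Fin T => t.val < k),
        (-η * ∑ a, p t a * ℓ t a + η ^ 2 / 8)) := by
  induction k with
  | zero => simp
  | succ k ih =>
    let t : Fin T := ⟨k, hk⟩
    have hins : univ.filter (fun s : Fin T => s.val < k + 1) =
        insert t (univ.filter fun s : Fin T => s.val < k) := by
      ext s
      simp [t, Fin.ext_iff]
      omega
    have hnot : t ∉ univ.filter fun s : Fin T => s.val < k := by simp [t]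
    have hstep := sum_mul_exp_neg_le
      (v := fun a => Real.exp (-η * ∑ s ∈ univ.filter (fun s : Fin T => s.val < k), ℓ s a))
      (fun a => Real.exp_pos _) (hℓ t) η
    have hpt (a : A) := hp t a
    simp only [Fin.lt_def, t] at hpt
    simp only [t, ← hpt] at hstep
    simp only [hins, sum_insert hnot]
    calc _ = _ := sum_congr rfl fun a _ => by rw [mul_add, add_comm, Real.exp_add]
      _ ≤ _ := hstep
      _ ≤ _ := mul_le_mul_of_nonneg_right (ih (by omega)) (Real.exp_pos _).le
      _ = _ := by rw [mul_assoc, ← Real.exp_add, add_comm]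

/-- Exponential-weights (Hedge) regret bound: with learning rate η > 0 and losses
in [0,1], the regret against the best fixed action is at most (log A₀)/η + ηT/8. -/
theorem hedge_regret_bound
    {A : Type*} [Fintype A] [Nonempty A]
    (A₀ : ℕ) (hA₀ : A₀ = Fintype.card A)
    (T : ℕ) (hT : 1 ≤ T)
    (ℓ : Fin T → A → ℝ) (hℓ : ∀ t a, 0 ≤ ℓ t a ∧ ℓ t a ≤ 1)
    (η : ℝ) (hη : 0 < η)
    (p : Fin T → A → ℝ)
    (hp : ∀ (t : Fin T) (a : A),
      p t a = Real.exp (-η * ∑ s ∈ univ.filter (fun s : Fin T => s < t), ℓ s a) /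
        ∑ b : A, Real.exp (-η * ∑ s ∈ univ.filter (fun s : Fin T => s < t), ℓ s b)) :
    (∑ t : Fin T, ∑ a : A, p t a * ℓ t a) -
        univ.inf' univ_nonempty (fun a : A => ∑ t : Fin T, ℓ t a)
      ≤ Real.log A₀ / η + η * T / 8 := by
  obtain ⟨a, -, ha⟩ := exists_mem_eq_inf' univ_nonempty fun a : A => ∑ t : Fin T, ℓ t a
  rw [ha]
  have hbound := sum_exp_cumulative_loss_le hℓ hp le_rfl
  simp only [Fin.is_lt, filter_true] at hbound
  have hexp := (single_le_sum (f := fun a => Real.exp (-η * ∑ t, ℓ t a))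
    (fun b _ => (Real.exp_pos _).le) (mem_univ a)).trans hbound
  have hlog := Real.log_le_log (Real.exp_pos _) hexp
  rw [Real.log_exp, Real.log_mul (by simp) (Real.exp_ne_zero _), Real.log_exp, ← hA₀,
    sum_add_distrib, ← mul_sum, sum_const, card_univ, Fintype.card_fin, nsmul_eq_mul] at hlog
  refine le_of_mul_le_mul_left ?_ hη
  rw [mul_add, mul_div_cancel₀ _ hη.ne']
  linarith
end

section
/- Expected regret of Exp3. Let A₀ ≥ 2 and T ≥ 1 be natural numbers, let the action set be Fin A₀, and let ℓ : Fin T → Fin A₀ → ℝ be an arbitrary loss sequence with 0 ≤ ℓ t a ≤ 1. Define the Exp3 algorithm with learning rate η = √(log A₀ / (T · A₀)) as the following random process, expressed as a PMF μ on action sequences Fin T → Fin A₀ built by sequential sampling: maintain cumulative loss estimates L̂_0(a) = 0 for all a; at round t, play a_t drawn from p_t(a) = exp(−η·L̂_{t−1}(a)) / Σ_b exp(−η·L̂_{t−1}(b)), then update L̂_t(a) = L̂_{t−1}(a) + (ℓ t a / p_t(a))·1{a_t = a}. Then the expected regret satisfies E_{μ}[ Σ_t ℓ t (a_t) ] − min_{a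 ∈ Fin A₀} Σ_t ℓ t a ≤ 2·√(T · A₀ · log A₀). -/
open Finset

/-- Sequential sampling with possibly unnormalised adapted weights: if the round-`t` weights depend
only on the past and have total mass `c t`, the product weights have total mass `∏ t, c t`. -/
theorem sum_prod_adapted {α : Type*} [Fintype α] [Nonempty α] {n : ℕ}
    (q : (Fin n → α) → Fin n → α → ℝ) (c : Fin n → ℝ)
    (hq : ∀ s s' t, (∀ i < t, s i = s' i) → q s t = q s' t)
    (hc : ∀ s t, ∑ a, q s t a = c t) :
    ∑ s, ∏ t, q s t (s t) = ∏ t, c t := by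
  induction n with
  | zero => simp
  | succ n ih =>
    obtain ⟨s₀⟩ : Nonempty (Fin (n + 1) → α) := inferInstance
    have htail (a : α) :
        ∑ s : Fin n → α, ∏ i : Fin n, q (Fin.cons a s) i.succ (s i) = ∏ i : Fin n, c i.succ := by
      refine ih (fun s i => q (Fin.cons a s) i.succ) (fun i => c i.succ) ?_ (fun s i => hc _ _)
      intro s s' t h
      refine hq _ _ _ fun i hi => ?_
      cases i using Fin.cases with
      | zero => simp
      | succ j => simpa using h j (Fin.succ_lt_succ_iff.mp hi)
    have hhead (s : Fin (n + 1) → α) : q s 0 = q s₀ 0 :=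
      hq _ _ _ fun i hi => absurd hi (Fin.not_lt_zero i)
    rw [← (Fin.consEquiv fun _ => α).sum_comp, Fintype.sum_prod_type]
    change ∑ a, ∑ s : Fin n → α, ∏ t, q (Fin.cons a s) t ((Fin.cons a s : Fin (n + 1) → α) t) = _
    simp only [Fin.prod_univ_succ, Fin.cons_zero, Fin.cons_succ, hhead,
      ← mul_sum, htail, ← sum_mul, hc]

/-- Importance weighting is unbiased: under sequential sampling from positive adapted
distributions, the expectation of `g (s t) / q s t (s t)` is `∑ a, g a`. -/
theorem sum_prod_adapted_mul_div {α : Type*} [Fintype α] [Nonempty α] {n : ℕ}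
    (q : (Fin n → α) → Fin n → α → ℝ)
    (hq : ∀ s s' t, (∀ i < t, s i = s' i) → q s t = q s' t)
    (hpos : ∀ s t a, 0 < q s t a) (hsum : ∀ s t, ∑ a, q s t a = 1)
    (t : Fin n) (g : α → ℝ) :
    ∑ s, (∏ i, q s i (s i)) * (g (s t) / q s t (s t)) = ∑ a, g a := by
  have h := sum_prod_adapted (fun s => Function.update (q s) t g)
    (Function.update (fun _ => 1) t (∑ a, g a)) ?_ ?_
  · rw [prod_update_of_mem (mem_univ t), prod_const_one, mul_one] at h
    rw [← h]
    refine sum_congr rfl fun s _ => ?_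
    have hrest : ∏ i ∈ univ.erase t, Function.update (q s) t g i (s i) =
        ∏ i ∈ univ.erase t, q s i (s i) :=
      prod_congr rfl fun i hi => by rw [Function.update_of_ne (ne_of_mem_erase hi)]
    rw [← mul_prod_erase univ _ (mem_univ t),
      ← mul_prod_erase univ (fun i => Function.update (q s) t g i (s i)) (mem_univ t),
      Function.update_self, hrest]
    have := (hpos s t (s t)).ne'
    field_simp
  · intro s s' i h
    rcases eq_or_ne i t with rfl | hi
    · simp
    · simpa [Function.update_of_ne hi] using hq s s' i h
  · intro s i
    rcases eq_or_ne i t with rfl | hi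
    · simp
    · simpa [Function.update_of_ne hi] using hsum s i

theorem exp_neg_le_one_sub_add_sq {x : ℝ} (hx : 0 ≤ x) : Real.exp (-x) ≤ 1 - x + x ^ 2 := by
  rw [Real.exp_neg, inv_le_comm₀ (Real.exp_pos x) (by nlinarith [sq_nonneg (x - 1)])]
  refine le_trans ?_ (Real.add_one_le_exp x)
  rw [inv_le_iff_one_le_mul₀ (by nlinarith [sq_nonneg (x - 1)])]
  nlinarith [pow_nonneg hx 3]

/-- One step of exponential weights in which only the coordinate `k` is charged, with the
importance-weighted loss `x / r`, where `r` is the softmax probability of `k`. -/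
theorem log_sum_exp_step {α : Type*} [Fintype α] [DecidableEq α] (L L' : α → ℝ) (k : α)
    {η x r : ℝ} (hη : 0 ≤ η) (hx0 : 0 ≤ x) (hx1 : x ≤ 1)
    (hr : r = Real.exp (-η * L k) / ∑ b, Real.exp (-η * L b))
    (hL : ∀ a, L' a = L a + x / r * (if k = a then 1 else 0)) :
    Real.log (∑ b, Real.exp (-η * L' b)) ≤
      Real.log (∑ b, Real.exp (-η * L b)) - η * x + η ^ 2 * (1 / r) := by
  have : Nonempty α := ⟨k⟩
  set W := ∑ b, Real.exp (-η * L b) with hW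
  have hWpos : 0 < W := sum_pos (fun _ _ => Real.exp_pos _) univ_nonempty
  have hrpos : 0 < r := by rw [hr]; exact div_pos (Real.exp_pos _) hWpos
  have hk : Real.exp (-η * L k) = r * W := by rw [hr]; field_simp
  have hW' : ∑ b, Real.exp (-η * L' b) = W * (1 - r + r * Real.exp (-(η * (x / r)))) := by
    have hrest : ∑ b ∈ univ.erase k, Real.exp (-η * L' b) =
        ∑ b ∈ univ.erase k, Real.exp (-η * L b) :=
      sum_congr rfl fun b hb => by simp [hL, (ne_of_mem_erase hb).symm]
    have hsplit := add_sum_erase univ (fun b => Real.exp (-η * L b)) (mem_univ k)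
    simp only [hk, ← hW] at hsplit
    have hk' : Real.exp (-η * L' k) = r * W * Real.exp (-(η * (x / r))) := by
      rw [← hk, ← Real.exp_add, hL, if_pos rfl]
      ring_nf
    rw [← add_sum_erase univ _ (mem_univ k), hrest, hk']
    linear_combination hsplit
  have hW'pos : 0 < ∑ b, Real.exp (-η * L' b) :=
    sum_pos (fun _ _ => Real.exp_pos _) univ_nonempty
  have hfac : 0 < 1 - r + r * Real.exp (-(η * (x / r))) := by
    rw [hW'] at hW'pos
    exact pos_of_mul_pos_right hW'pos hWpos.le
  rw [hW', Real.log_mul hWpos.ne' hfac.ne']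
  have hlog := Real.log_le_sub_one_of_pos hfac
  have hexp := mul_le_mul_of_nonneg_left
    (exp_neg_le_one_sub_add_sq (x := η * (x / r)) (by positivity)) hrpos.le
  have hquad : r * (1 - η * (x / r) + (η * (x / r)) ^ 2) = r - η * x + η ^ 2 * (x ^ 2 / r) := by
    field_simp
  have hsq : η ^ 2 * (x ^ 2 / r) ≤ η ^ 2 * (1 / r) := by
    gcongr
    exact pow_le_one₀ hx0 hx1
  linarith

/-- Expected regret of Exp3 with learning rate η = √(log A₀ / (T·A₀)):
the expected total realized loss exceeds that of the best fixed action by at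
most 2·√(T·A₀·log A₀). The law μ of the played-action sequence is the product
of the round-wise softmax probabilities, each depending on the history through
the importance-weighted cumulative loss estimates `Lhat`. -/
theorem exp3_expected_regret
    (A₀ T : ℕ) (hA₀ : 2 ≤ A₀) (hT : 1 ≤ T)
    (ℓ : Fin T → Fin A₀ → ℝ) (hℓ : ∀ t a, 0 ≤ ℓ t a ∧ ℓ t a ≤ 1)
    (η : ℝ) (hη : η = Real.sqrt (Real.log A₀ / (T * A₀)))
    -- cumulative importance-weighted loss estimates along a played sequence
    (Lhat : (Fin T → Fin A₀) → ℕ → Fin A₀ → ℝ)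
    -- round-t sampling distribution along a played sequence
    (p : (Fin T → Fin A₀) → Fin T → Fin A₀ → ℝ)
    (hL0 : ∀ seq a, Lhat seq 0 a = 0)
    (hp : ∀ seq (t : Fin T) (a : Fin A₀),
      p seq t a = Real.exp (-η * Lhat seq (t : ℕ) a) /
        ∑ b : Fin A₀, Real.exp (-η * Lhat seq (t : ℕ) b))
    (hLrec : ∀ seq (t : Fin T) (a : Fin A₀),
      Lhat seq ((t : ℕ) + 1) a =
        Lhat seq (t : ℕ) a + (ℓ t a / p seq t a) * (if seq t = a then 1 else 0))
    -- the joint law of the played-action sequence: sequential sampling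
    (μ : PMF (Fin T → Fin A₀))
    (hμ : ∀ seq : Fin T → Fin A₀,
      (μ seq).toReal = ∏ t : Fin T, p seq t (seq t)) :
    (∑ seq : Fin T → Fin A₀, (μ seq).toReal * ∑ t : Fin T, ℓ t (seq t)) -
        univ.inf' (univ_nonempty_iff.mpr ⟨⟨0, by omega⟩⟩) (fun a : Fin A₀ => ∑ t : Fin T, ℓ t a)
      ≤ 2 * Real.sqrt (T * A₀ * Real.log A₀) := by
  have : NeZero A₀ := ⟨by omega⟩
  have hA : (2 : ℝ) ≤ A₀ := by exact_mod_cast hA₀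
  have hTpos : (0 : ℝ) < T := by exact_mod_cast hT
  have hlogA : 0 < Real.log A₀ := Real.log_pos (by linarith)
  have hTA : (0 : ℝ) < T * A₀ := by positivity
  have hηpos : 0 < η := by rw [hη]; positivity
  have hηsq : η ^ 2 * (T * A₀) = Real.log A₀ := by
    rw [hη, Real.sq_sqrt (by positivity)]
    field_simp
  have hηsqrt : η * Real.sqrt (T * A₀ * Real.log A₀) = Real.log A₀ := by
    rw [hη, ← Real.sqrt_mul (by positivity)]
    have : Real.log A₀ / (T * A₀) * (T * A₀ * Real.log A₀) = Real.log A₀ ^ 2 := by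
      field_simp
    rw [this, Real.sqrt_sq hlogA.le]
  have hWpos (s : Fin T → Fin A₀) (t : ℕ) : 0 < ∑ b, Real.exp (-η * Lhat s t b) :=
    sum_pos (fun _ _ => Real.exp_pos _) univ_nonempty
  have hppos (s : Fin T → Fin A₀) (t : Fin T) (a : Fin A₀) : 0 < p s t a := by
    rw [hp]
    exact div_pos (Real.exp_pos _) (hWpos s t)
  have hpsum (s : Fin T → Fin A₀) (t : Fin T) : ∑ a, p s t a = 1 := by
    simp only [hp, ← sum_div]
    exact div_self (hWpos s t).ne'
  have hLad (s s' : Fin T → Fin A₀) (t : ℕ) (htT : t ≤ T)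
      (h : ∀ i : Fin T, (i : ℕ) < t → s i = s' i) : Lhat s t = Lhat s' t := by
    induction t with
    | zero => ext a; rw [hL0, hL0]
    | succ t ih =>
      have hprev := ih (by omega) fun i hi => h i (by omega)
      ext a
      have h1 := hLrec s ⟨t, htT⟩ a
      have h2 := hLrec s' ⟨t, htT⟩ a
      simp only [hp, hprev, h ⟨t, htT⟩ (Nat.lt_succ_self t)] at h1 h2
      rw [h1, h2]
  have hpad (s s' : Fin T → Fin A₀) (t : Fin T) (h : ∀ i < t, s i = s' i) : p s t = p s' t := by
    ext a
    rw [hp, hp, hLad s s' t t.2.le fun i hi => h i hi]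
  have hpotential (s : Fin T → Fin A₀) (n : ℕ) (hn : n ≤ T) :
      Real.log (∑ b, Real.exp (-η * Lhat s n b)) ≤ Real.log A₀ +
        ∑ t : Fin n, (η ^ 2 * (1 / p s (t.castLE hn) (s (t.castLE hn))) -
          η * ℓ (t.castLE hn) (s (t.castLE hn))) := by
    induction n with
    | zero => simp [hL0]
    | succ n ih =>
      have hstep := log_sum_exp_step (Lhat s n) (Lhat s (n + 1)) (s ⟨n, hn⟩) hηpos.le
        (hℓ ⟨n, hn⟩ (s ⟨n, hn⟩)).1 (hℓ ⟨n, hn⟩ (s ⟨n, hn⟩)).2 (hp s ⟨n, hn⟩ (s ⟨n, hn⟩)) (by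
          intro a
          rw [hLrec s ⟨n, hn⟩ a]
          split_ifs with h
          · rw [h]
          · simp)
      have hprev := ih (by omega)
      rw [Fin.sum_univ_castSucc]
      simp only [Fin.castLE_castSucc] at hprev ⊢
      have hlast : Fin.castLE hn (Fin.last n) = ⟨n, hn⟩ := rfl
      rw [hlast]
      linarith
  have hLsum (s : Fin T → Fin A₀) (a : Fin A₀) (n : ℕ) (hn : n ≤ T) :
      Lhat s n a = ∑ t : Fin n, (if s (t.castLE hn) = a then ℓ (t.castLE hn) a else 0) /
        p s (t.castLE hn) (s (t.castLE hn)) := by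
    induction n with
    | zero => simp [hL0]
    | succ n ih =>
      rw [Fin.sum_univ_castSucc]
      have hlast : Fin.castLE hn (Fin.last n) = ⟨n, hn⟩ := rfl
      simp only [Fin.castLE_castSucc, hlast]
      rw [hLrec s ⟨n, hn⟩ a, ih (by omega)]
      congr 1
      split_ifs with h
      · rw [h, mul_one]
      · simp
  have hpath (s : Fin T → Fin A₀) (a : Fin A₀) :
      η * ∑ t, ℓ t (s t) ≤ Real.log A₀ + η ^ 2 * ∑ t, 1 / p s t (s t) +
        η * ∑ t, (if s t = a then ℓ t a else 0) / p s t (s t) := by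
    have hup := hpotential s T le_rfl
    have hlow : -η * Lhat s T a ≤ Real.log (∑ b, Real.exp (-η * Lhat s T b)) := by
      rw [Real.le_log_iff_exp_le (hWpos s T)]
      exact single_le_sum (f := fun b => Real.exp (-η * Lhat s T b))
        (fun _ _ => (Real.exp_pos _).le) (mem_univ a)
    rw [hLsum s a T le_rfl] at hlow
    simp only [Fin.castLE_rfl, id_eq, sum_sub_distrib, ← mul_sum] at hup hlow
    linarith
  have hmass : ∑ s, ∏ t, p s t (s t) = 1 := by
    simpa using sum_prod_adapted p (fun _ => 1) hpad hpsum
  have hexpect (g : Fin T → Fin A₀ → ℝ) :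
      ∑ s, (∏ i, p s i (s i)) * ∑ t, g t (s t) / p s t (s t) = ∑ t, ∑ a, g t a := by
    simp only [mul_sum]
    rw [sum_comm]
    exact sum_congr rfl fun t _ => sum_prod_adapted_mul_div p hpad hppos hpsum t (g t)
  have hregret (a : Fin A₀) :
      (∑ s, (∏ t, p s t (s t)) * ∑ t, ℓ t (s t)) - ∑ t, ℓ t a ≤
        2 * Real.sqrt (T * A₀ * Real.log A₀) := by
    have hsum := sum_le_sum fun s (_ : s ∈ univ) =>
      mul_le_mul_of_nonneg_left (hpath s a)
        (prod_nonneg fun t (_ : t ∈ univ) => (hppos s t (s t)).le)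
    simp only [mul_add, sum_add_distrib, mul_left_comm _ η, mul_left_comm _ (η ^ 2), ← mul_sum,
      ← sum_mul, hmass] at hsum
    rw [hexpect fun _ _ => 1, hexpect fun t b => if b = a then ℓ t a else 0] at hsum
    simp only [sum_const, card_univ, Fintype.card_fin, nsmul_eq_mul, mul_one, one_mul,
      sum_ite_eq', mem_univ, if_true] at hsum
    refine le_of_mul_le_mul_left ?_ hηpos
    linarith
  obtain ⟨a, -, ha⟩ := exists_mem_eq_inf' (univ_nonempty (α := Fin A₀))
    fun a : Fin A₀ => ∑ t : Fin T, ℓ t a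
  simp only [hμ]
  rw [ha]
  exact hregret a
end
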